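/- Let X be a Noetherian space and let α := ||X||. Then the space X* of finite words over X, with the word topology, is Noetherian, and its stature is: ||X*|| = 1 if α = 0, and ||X*|| = ω^(ω^(α')) otherwise, where α' = α − 1 if α is finite and nonzero, α' = α + 1 if α = ε + n for some critical ordinal ε and natural number n, and α' = α otherwise. -/

import Mathlib

open TopologicalSpace

/-- The ordinal rank of an element of a poset: defined by well-founded recursion as the least
ordinal strictly greater than the ranks of all strictly smaller elements (and `0` as a junk
value if the strict order is not well-founded). -/
noncomputable def wfRank {α : Type*} [Preorder α] (a : α) : Ordinal :=
  open Classical in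
  if h : WellFoundedLT α then @IsWellFounded.rank α (· < ·) h a else 0

/-- The ordinal rank of a poset: the least ordinal strictly greater than the ranks of
all its elements. -/
noncomputable def ordRank (α : Type*) [Preorder α] : Ordinal :=
  ⨆ a : α, wfRank a + 1

/-- The stature of a topological space: the rank of the whole space in the poset of
closed subsets ordered by inclusion (equivalently, the ordinal rank of the poset of proper
closed subsets). -/
noncomputable def stature (X : Type*) [TopologicalSpace X] : Ordinal :=
  wfRank (⊤ : Closeds X)

/-- The sobrification rank of a topological space: the ordinal rank of the poset of
irreducible closed subsets ordered by inclusion. -/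
noncomputable def sobRank (X : Type*) [TopologicalSpace X] : Ordinal :=
  ordRank (IrreducibleCloseds X)

/-- The space of finite words over a topological space `X`: the set of finite lists over `X`,
equipped with the word topology, generated by the sets
`X*U₁X*⋯X*UₙX* = {w | w has a (scattered) subword whose letters lie in U₁, …, Uₙ in order}`
for `U₁, …, Uₙ` open in `X`. -/
def WordSpace (X : Type*) [TopologicalSpace X] : Type _ := List X

instance WordSpace.instTopologicalSpace (X : Type*) [TopologicalSpace X] :
    TopologicalSpace (WordSpace X) :=
  TopologicalSpace.generateFrom
    { s : Set (List X) | ∃ Us : List (Set X), (∀ U ∈ Us, IsOpen U) ∧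
        s = { w : List X | ∃ l : List X, l.Sublist w ∧ List.Forall₂ (· ∈ ·) l Us } }

/-- A critical ordinal is one satisfying `ω ^ ε = ε`. -/
def IsCritical (e : Ordinal) : Prop := Ordinal.omega0 ^ e = e

/-- `adjsw α` is `α + 1` if `α = ε + n` for some critical ordinal `ε` and natural number `n`,
and `α` otherwise. -/
noncomputable def adjsw (a : Ordinal) : Ordinal :=
  open Classical in
  if ∃ (e : Ordinal) (n : ℕ), IsCritical e ∧ a = e + n then a + 1 else a

/-- `schmidtPrime α` is `α - 1` if `α` is finite (and nonzero), `α + 1` if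
`α = ε + n` with `ε` critical and `n ∈ ℕ`, and `α` otherwise. -/
noncomputable def schmidtPrime (a : Ordinal) : Ordinal :=
  open Classical in
  if a < Ordinal.omega0 then a - 1 else adjsw a

section Hessenberg

open Ordinal

/-- The Hessenberg (natural) sum of two ordinals. -/
noncomputable def hessenbergAdd (a b : Ordinal.{u}) : Ordinal.{u} :=
  max (⨆ x : Set.Iio a, hessenbergAdd x.1 b + 1) (⨆ x : Set.Iio b, hessenbergAdd a x.1 + 1)
termination_by (a, b)
decreasing_by
  · exact Prod.Lex.left _ _ x.2
  · exact Prod.Lex.right _ x.2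

theorem hessenbergAdd_lt_left {a a' : Ordinal.{u}} (h : a' < a) (b : Ordinal.{u}) :
    hessenbergAdd a' b < hessenbergAdd a b := by
  rw [hessenbergAdd.eq_1 a b]
  refine lt_max_of_lt_left ((lt_add_one _).trans_le ?_)
  exact Ordinal.le_iSup (fun x : Set.Iio a => hessenbergAdd x.1 b + 1) ⟨a', h⟩

theorem hessenbergAdd_lt_right (a : Ordinal.{u}) {b b' : Ordinal.{u}} (h : b' < b) :
    hessenbergAdd a b' < hessenbergAdd a b := by
  rw [hessenbergAdd.eq_1 a b]
  refine lt_max_of_lt_right ((lt_add_one _).trans_le ?_)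
  exact Ordinal.le_iSup (fun x : Set.Iio b => hessenbergAdd a x.1 + 1) ⟨b', h⟩

theorem hessenbergAdd_le {a b c : Ordinal.{u}} (h₁ : ∀ x < a, hessenbergAdd x b < c)
    (h₂ : ∀ x < b, hessenbergAdd a x < c) : hessenbergAdd a b ≤ c := by
  rw [hessenbergAdd.eq_1 a b]
  refine max_le (Ordinal.iSup_le fun x => ?_) (Ordinal.iSup_le fun x => ?_)
  · exact Order.add_one_le_of_lt (h₁ _ x.2)
  · exact Order.add_one_le_of_lt (h₂ _ x.2)

theorem hessenbergAdd_mono {a a' b b' : Ordinal.{u}} (ha : a' ≤ a) (hb : b' ≤ b) :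
    hessenbergAdd a' b' ≤ hessenbergAdd a b := by
  have h₁ : StrictMono fun x => hessenbergAdd x b' := fun _ _ h => hessenbergAdd_lt_left h _
  have h₂ : StrictMono fun x => hessenbergAdd a x := fun _ _ h => hessenbergAdd_lt_right _ h
  exact (h₁.monotone ha).trans (h₂.monotone hb)

theorem exists_eq_opow_mul_natCast_add {a c : Ordinal.{u}} {n : ℕ} (h : a < ω ^ c * (n : Ordinal)) :
    ∃ m : ℕ, m < n ∧ ∃ r < ω ^ c, a = ω ^ c * (m : Ordinal) + r := by
  have hc : (ω ^ c : Ordinal.{u}) ≠ 0 := opow_ne_zero _ omega0_ne_zero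
  have h1 : a / ω ^ c < n := (Ordinal.lt_mul_iff_div_lt hc).1 h
  obtain ⟨m, hm⟩ := lt_omega0.1 (h1.trans (natCast_lt_omega0 n))
  refine ⟨m, by rw [hm] at h1; exact_mod_cast h1, a % ω ^ c, Ordinal.mod_lt _ hc, ?_⟩
  rw [← hm, Ordinal.div_add_mod]

theorem hessenbergAdd_opow_mul_add_le {e : Ordinal.{u}}
    (he : ∀ a < ω ^ e, ∀ b < ω ^ e, hessenbergAdd a b < ω ^ e) :
    ∀ (a b : Ordinal.{u}) (m n : ℕ) (r s : Ordinal.{u}), r < ω ^ e → s < ω ^ e →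
      a = ω ^ e * (m : Ordinal) + r → b = ω ^ e * (n : Ordinal) + s →
      hessenbergAdd a b ≤ ω ^ e * ((m + n : ℕ) : Ordinal) + hessenbergAdd r s := by
  have key : ∀ (a' : Ordinal.{u}) (m : ℕ) (r : Ordinal.{u}), r < ω ^ e →
      a' < ω ^ e * (m : Ordinal) + r → ∃ (m' : ℕ) (r' : Ordinal.{u}), r' < ω ^ e ∧
        a' = ω ^ e * (m' : Ordinal) + r' ∧ (m' < m ∨ (m' = m ∧ r' < r)) := by
    intro a' m r hr h
    have h' : a' < ω ^ e * ((m + 1 : ℕ) : Ordinal) := by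
      rw [Nat.cast_add_one, mul_add, mul_one]
      exact h.trans_le (by gcongr)
    obtain ⟨m', hm', r', hr', rfl⟩ := exists_eq_opow_mul_natCast_add h'
    refine ⟨m', r', hr', rfl, ?_⟩
    rcases Nat.lt_succ_iff_lt_or_eq.1 hm' with h1 | rfl
    · exact Or.inl h1
    · exact Or.inr ⟨rfl, lt_of_add_lt_add_left h⟩
  have jump : ∀ (k l : ℕ) (x y : Ordinal.{u}), k < l → x < ω ^ e →
      ω ^ e * (k : Ordinal) + x < ω ^ e * (l : Ordinal) + y := by
    intro k l x y hkl hx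
    calc ω ^ e * (k : Ordinal) + x < ω ^ e * (k : Ordinal) + ω ^ e := by gcongr
      _ = ω ^ e * ((k + 1 : ℕ) : Ordinal) := by rw [Nat.cast_add_one, mul_add, mul_one]
      _ ≤ ω ^ e * (l : Ordinal) := by gcongr; exact hkl
      _ ≤ _ := le_self_add
  intro a
  induction a using WellFoundedLT.induction with
  | ind a iha =>
  intro b
  induction b using WellFoundedLT.induction with
  | ind b ihb =>
  rintro m n r s hr hs rfl rfl
  refine hessenbergAdd_le (fun x hx => ?_) (fun x hx => ?_)
  · obtain ⟨m', r', hr', rfl, h⟩ := key x m r hr hx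
    refine (iha _ hx _ m' n r' s hr' hs rfl rfl).trans_lt ?_
    rcases h with h | ⟨rfl, h⟩
    · exact jump _ _ _ _ (by omega) (he _ hr' _ hs)
    · exact (add_lt_add_iff_left _).2 (hessenbergAdd_lt_left h s)
  · obtain ⟨n', s', hs', rfl, h⟩ := key x n s hs hx
    refine (ihb _ hx m n' r s' hr hs' rfl rfl).trans_lt ?_
    rcases h with h | ⟨rfl, h⟩
    · exact jump _ _ _ _ (by omega) (he _ hr _ hs')
    · exact (add_lt_add_iff_left _).2 (hessenbergAdd_lt_right r h)

theorem hessenbergAdd_lt_omega0_opow (c : Ordinal.{u}) :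
    ∀ a < ω ^ c, ∀ b < ω ^ c, hessenbergAdd a b < ω ^ c := by
  induction c using WellFoundedLT.induction with
  | ind c ih =>
  intro a ha b hb
  rcases eq_or_ne c 0 with rfl | hc
  · rw [opow_zero] at *
    rw [Order.lt_one_iff] at ha hb
    subst ha hb
    refine lt_of_le_of_lt (hessenbergAdd_le (c := 0) ?_ ?_) zero_lt_one <;> simp
  obtain ⟨e, hec, k, hak⟩ := (lt_omega0_opow hc).1 ha
  obtain ⟨e', hec', k', hbk⟩ := (lt_omega0_opow hc).1 hb
  have hE : max e e' < c := max_lt hec hec'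
  have ha2 : a < ω ^ max e e' * (k : Ordinal) := hak.trans_le
    (mul_le_mul_left (opow_le_opow_right omega0_pos (le_max_left _ _)) _)
  have hb2 : b < ω ^ max e e' * (k' : Ordinal) := hbk.trans_le
    (mul_le_mul_left (opow_le_opow_right omega0_pos (le_max_right _ _)) _)
  obtain ⟨m, -, r, hr, hra⟩ := exists_eq_opow_mul_natCast_add ha2
  obtain ⟨n, -, s, hs, hsb⟩ := exists_eq_opow_mul_natCast_add hb2
  have h := hessenbergAdd_opow_mul_add_le (ih _ hE) a b m n r s hr hs hra hsb
  refine h.trans_lt ?_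
  calc ω ^ max e e' * ((m + n : ℕ) : Ordinal) + hessenbergAdd r s
      < ω ^ max e e' * ((m + n : ℕ) : Ordinal) + ω ^ max e e' := by
        gcongr; exact ih _ hE _ hr _ hs
    _ = ω ^ max e e' * ((m + n + 1 : ℕ) : Ordinal) := by
        rw [Nat.cast_add_one, mul_add, mul_one]
    _ < ω ^ c := opow_mul_lt_opow (natCast_lt_omega0 _) hE

end Hessenberg

section Rank

theorem wfRank_eq {α : Type u} [Preorder α] [h : WellFoundedLT α] (a : α) :
    wfRank a = IsWellFounded.rank (α := α) (· < ·) a := by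
  simp only [wfRank, dif_pos h]

theorem wfRank_strictMono {α : Type u} [Preorder α] [WellFoundedLT α] :
    StrictMono (wfRank : α → Ordinal.{u}) := by
  intro a b h
  rw [wfRank_eq, wfRank_eq]
  exact WellFoundedLT.rank_strictMono h

theorem wfRank_le_iff {α : Type u} [Preorder α] [WellFoundedLT α] {a : α} {o : Ordinal.{u}} :
    wfRank a ≤ o ↔ ∀ b < a, wfRank b < o := by
  refine ⟨fun h b hb => (wfRank_strictMono hb).trans_le h, fun h => ?_⟩
  rw [wfRank_eq, IsWellFounded.rank_eq]
  refine Ordinal.iSup_le fun b => Order.succ_le_of_lt ?_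
  rw [← wfRank_eq]
  exact h _ b.2

theorem lt_wfRank_iff {α : Type u} [Preorder α] [WellFoundedLT α] {a : α} {o : Ordinal.{u}} :
    o < wfRank a ↔ ∃ b < a, o ≤ wfRank b := by
  rw [← not_le, wfRank_le_iff]
  push Not
  rfl

theorem exists_wfRank_eq {α : Type u} [Preorder α] [WellFoundedLT α] {a : α} {o : Ordinal.{u}}
    (h : o < wfRank a) : ∃ b < a, wfRank b = o := by
  induction a using WellFoundedLT.induction with
  | ind a ih =>
  obtain ⟨b, hb, hob⟩ := lt_wfRank_iff.1 h
  rcases hob.eq_or_lt with rfl | hlt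
  · exact ⟨b, hb, rfl⟩
  · obtain ⟨c, hc, rfl⟩ := ih b hb hlt
    exact ⟨c, hc.trans hb, rfl⟩

theorem wfRank_le_of_strictMono {α : Type u} [Preorder α] [WellFoundedLT α]
    {f : α → Ordinal.{u}} (hf : StrictMono f) (a : α) : wfRank a ≤ f a := by
  induction a using WellFoundedLT.induction with
  | ind a ih => exact wfRank_le_iff.2 fun b hb => (ih b hb).trans_lt (hf hb)

theorem wellFoundedLT_of_strictMono {α : Type*} [Preorder α] {β : Type*} [Preorder β]
    [WellFoundedLT β] {f : α → β} (hf : StrictMono f) : WellFoundedLT α :=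
  ⟨Subrelation.wf (fun h => hf h) (InvImage.wf f (wellFounded_lt (α := β)))⟩

theorem wfRank_le_wfRank_of_strictMono {α β : Type u} [Preorder α] [Preorder β]
    [WellFoundedLT β] {f : α → β} (hf : StrictMono f) (a : α) : wfRank a ≤ wfRank (f a) :=
  have := wellFoundedLT_of_strictMono hf
  wfRank_le_of_strictMono (wfRank_strictMono.comp hf) a

theorem wfRank_add_le {P R : Type u} [Preorder P] [PartialOrder R] [WellFoundedLT P]
    [WellFoundedLT R] {φ : P → R} (hφ : StrictMono φ) {r : R} (hr : ∀ x, r ≤ φ x) (x : P) :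
    wfRank r + wfRank x ≤ wfRank (φ x) := by
  induction x using WellFoundedLT.induction with
  | ind x ihx =>
  refine le_of_forall_lt fun o ho => ?_
  rcases lt_or_ge o (wfRank r) with h1 | h1
  · exact h1.trans_le (wfRank_strictMono.monotone (hr x))
  · obtain ⟨o', rfl⟩ := exists_add_of_le h1
    have h2 : o' < wfRank x := lt_of_add_lt_add_left ho
    obtain ⟨y, hy, hoy⟩ := lt_wfRank_iff.1 h2
    calc _ ≤ wfRank r + wfRank y := by gcongr
      _ ≤ wfRank (φ y) := ihx y hy
      _ < _ := wfRank_strictMono (hφ hy)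

/-- A well-founded poset containing strictly monotone copies of `P` between the consecutive values
of a map from `Q` has rank at least the product of the ranks. -/
theorem wfRank_mul_le {P Q R : Type u} [Preorder P] [Preorder Q] [PartialOrder R]
    [WellFoundedLT P] [WellFoundedLT Q] [WellFoundedLT R] (p : P) (ψ : Q → R)
    (h : ∀ d d', d' < d → ∃ φ : P → R, StrictMono φ ∧ (∀ x, ψ d' ≤ φ x) ∧ φ p ≤ ψ d) (d : Q) :
    wfRank p * wfRank d ≤ wfRank (ψ d) := by
  induction d using WellFoundedLT.induction with
  | ind d ih =>
  have hs : ∀ d' < d, wfRank p * (wfRank d' + 1) ≤ wfRank (ψ d) := by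
    intro d' hd
    obtain ⟨φ, hφ, hl, hu⟩ := h d d' hd
    calc wfRank p * (wfRank d' + 1) = wfRank p * wfRank d' + wfRank p := by
          rw [mul_add, mul_one]
      _ ≤ wfRank (ψ d') + wfRank p := by gcongr; exact ih d' hd
      _ ≤ wfRank (φ p) := wfRank_add_le hφ hl p
      _ ≤ _ := wfRank_strictMono.monotone hu
  refine le_of_forall_lt fun o ho => ?_
  obtain ⟨c, hc, hoc⟩ : ∃ c < wfRank d, o < wfRank p * (c + 1) := by
    rcases eq_or_ne (wfRank p) 0 with h0 | h0
    · simp [h0] at ho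
    · refine ⟨o / wfRank p, (Ordinal.lt_mul_iff_div_lt h0).1 ho, ?_⟩
      simpa [Order.succ_eq_add_one] using Ordinal.lt_mul_succ_div o h0
  obtain ⟨d', hd', hcd⟩ := lt_wfRank_iff.1 hc
  refine hoc.trans_le (le_trans ?_ (hs d' hd'))
  gcongr

end Rank

section Stature

open Topology Set

theorem noetherianSpace_of_wellFoundedLT_closeds {Y : Type*} [TopologicalSpace Y]
    (h : WellFoundedLT (Closeds Y)) : NoetherianSpace Y :=
  ((noetherianSpace_TFAE Y).out 0 1).2 h

/-- The closure of the direct image is a strictly monotone map of closed sets as soon as every open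
set of the source is the preimage of an open set. -/
theorem strictMono_closure_image {Y Z : Type*} [tY : TopologicalSpace Y] [tZ : TopologicalSpace Z]
    {i : Y → Z} (hi : TopologicalSpace.induced i tZ ≤ tY) :
    StrictMono fun C : Closeds Y => Closeds.closure (i '' (C : Set Y)) := by
  have key : ∀ C : Closeds Y, i ⁻¹' closure (i '' (C : Set Y)) = C := by
    intro C
    obtain ⟨D, hD, hDC⟩ : ∃ D, IsClosed D ∧ i ⁻¹' D = C :=
      isClosed_induced_iff.1 (C.isClosed.mono hi)
    refine subset_antisymm ?_ (image_subset_iff.1 subset_closure)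
    have h1 : closure (i '' (C : Set Y)) ⊆ D :=
      closure_minimal (image_subset_iff.2 hDC.ge) hD
    exact (preimage_mono h1).trans hDC.le
  refine Monotone.strictMono_of_injective (fun C D h => closure_mono (image_mono h)) ?_
  intro C D h
  have h2 : closure (i '' (C : Set Y)) = closure (i '' (D : Set Y)) := congrArg SetLike.coe h
  apply SetLike.coe_injective
  rw [← key C, ← key D, h2]

theorem noetherianSpace_of_induced_le {Y Z : Type*} [tY : TopologicalSpace Y]
    [tZ : TopologicalSpace Z] [NoetherianSpace Z] {i : Y → Z}
    (hi : TopologicalSpace.induced i tZ ≤ tY) : NoetherianSpace Y :=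
  noetherianSpace_of_wellFoundedLT_closeds
    (wellFoundedLT_of_strictMono (strictMono_closure_image hi))

theorem stature_le_of_induced_le {Y Z : Type u} [tY : TopologicalSpace Y]
    [tZ : TopologicalSpace Z] [NoetherianSpace Z] {i : Y → Z}
    (hi : TopologicalSpace.induced i tZ ≤ tY) : stature Y ≤ stature Z :=
  (wfRank_le_wfRank_of_strictMono (strictMono_closure_image hi) ⊤).trans
    (wfRank_strictMono.monotone le_top)

theorem induced_le_of_comp {Y Z W : Type*} [tY : TopologicalSpace Y] [tZ : TopologicalSpace Z]
    [TopologicalSpace W] {i : Y → Z} {g : Z → W} (hg : Continuous g) (hgi : IsInducing (g ∘ i)) :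
    TopologicalSpace.induced i tZ ≤ tY := by
  rw [hgi.eq_induced, ← induced_compose]
  exact induced_mono (continuous_iff_le_induced.1 hg)

theorem stature_le_of_comp {Y Z : Type u} {W : Type*} [TopologicalSpace Y] [TopologicalSpace Z]
    [TopologicalSpace W] [NoetherianSpace Z] {i : Y → Z} {g : Z → W} (hg : Continuous g)
    (hgi : IsInducing (g ∘ i)) : stature Y ≤ stature Z :=
  stature_le_of_induced_le (induced_le_of_comp hg hgi)

theorem stature_le_of_surjective {Y Z : Type u} [TopologicalSpace Y] [TopologicalSpace Z]
    [NoetherianSpace Y] {f : Y → Z} (hf : Continuous f) (hs : Function.Surjective f) :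
    stature Z ≤ stature Y := by
  refine (wfRank_le_wfRank_of_strictMono (f := fun C : Closeds Z => C.preimage hf) ?_ ⊤).trans
    (wfRank_strictMono.monotone le_top)
  refine Monotone.strictMono_of_injective (fun C D h x hx => h hx) ?_
  intro C D h
  exact SetLike.coe_injective (hs.preimage_injective (congrArg SetLike.coe h))

theorem stature_coe_closeds {Y : Type u} [TopologicalSpace Y] [NoetherianSpace Y]
    (C : Closeds Y) : stature (C : Set Y) = wfRank C := by
  apply le_antisymm
  · refine (wfRank_le_wfRank_of_strictMono (strictMono_closure_image
      (i := (Subtype.val : ↥(C : Set Y) → Y)) le_rfl) ⊤).trans (wfRank_strictMono.monotone ?_)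
    refine closure_minimal ?_ C.isClosed
    rintro _ ⟨x, -, rfl⟩
    exact x.2
  · have key : ∀ D : Closeds Y, D ≤ C →
        wfRank D ≤ wfRank (D.preimage
          (continuous_subtype_val : Continuous (Subtype.val : ↥(C : Set Y) → Y))) := by
      intro D
      induction D using WellFoundedLT.induction with
      | ind D ih =>
      intro hD
      refine wfRank_le_iff.2 fun E hE => (ih E hE (hE.le.trans hD)).trans_lt (wfRank_strictMono ?_)
      obtain ⟨hle, y, hy, hyE⟩ := SetLike.lt_iff_le_and_exists.1 hE
      refine SetLike.lt_iff_le_and_exists.2 ⟨fun x hx => hle hx, ⟨y, hD hy⟩, hy, hyE⟩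
    refine (key C le_rfl).trans (wfRank_strictMono.monotone le_top)

theorem stature_lt_of_isClosed {Y : Type u} [TopologicalSpace Y] [NoetherianSpace Y]
    {C : Closeds Y} (hC : C ≠ ⊤) : stature (C : Set Y) < stature Y := by
  rw [stature_coe_closeds]
  exact wfRank_strictMono hC.lt_top

theorem stature_eq_zero_iff {Y : Type u} [TopologicalSpace Y] [NoetherianSpace Y] :
    stature Y = 0 ↔ IsEmpty Y := by
  rw [← nonpos_iff_eq_zero, stature, wfRank_le_iff]
  constructor
  · intro h
    by_contra hne
    rw [not_isEmpty_iff] at hne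
    obtain ⟨y⟩ := hne
    refine not_lt_bot (h ⊥ (lt_of_le_of_ne bot_le fun h' => ?_))
    exact (h' ▸ (trivial : y ∈ (⊤ : Closeds Y)) : y ∈ (⊥ : Closeds Y))
  · intro _ C hC
    exact absurd (SetLike.ext fun y => isEmptyElim y) hC.ne

/-- A set that is Noetherian, of stature less than `o`, in the subspace topology. -/
def HasStatureLT {Y : Type u} [TopologicalSpace Y] (S : Set Y) (o : Ordinal.{u}) : Prop :=
  NoetherianSpace S ∧ stature S < o

theorem noetherianSpace_and_stature_le {Y : Type u} [TopologicalSpace Y] {o : Ordinal.{u}}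
    (h : ∀ C : Closeds Y, C ≠ ⊤ → HasStatureLT (C : Set Y) o) :
    NoetherianSpace Y ∧ stature Y ≤ o := by
  classical
  let f : Closeds Y → Ordinal.{u} := fun C => if C = ⊤ then o else stature (C : Set Y)
  have hf : StrictMono f := by
    intro D C hDC
    have hD : D ≠ ⊤ := (hDC.trans_le le_top).ne
    by_cases hC : C = ⊤
    · simpa [f, hD, hC] using (h D hD).2
    · simp only [f, hD, hC, if_false]
      have := (h C hC).1
      obtain ⟨hle, y, hy, hyD⟩ := SetLike.lt_iff_le_and_exists.1 hDC
      let D' : Closeds (C : Set Y) := D.preimage continuous_subtype_val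
      have hD' : D' ≠ ⊤ := by
        intro h'
        have : (⟨y, hy⟩ : (C : Set Y)) ∈ D' := h' ▸ trivial
        exact hyD this
      refine lt_of_le_of_lt ?_ (stature_lt_of_isClosed hD')
      exact stature_le_of_comp (Y := ↥(D : Set Y)) (Z := ↥(D' : Set (C : Set Y)))
        (i := fun x => ⟨⟨x.1, hle x.2⟩, x.2⟩)
        (continuous_subtype_val.comp continuous_subtype_val) IsInducing.subtypeVal
  have hw := wellFoundedLT_of_strictMono hf
  have hN := noetherianSpace_of_wellFoundedLT_closeds hw
  refine ⟨hN, (wfRank_le_of_strictMono hf ⊤).trans ?_⟩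
  simp [f]

theorem HasStatureLT.mono {Y : Type u} [TopologicalSpace Y] {S T : Set Y} {o o' : Ordinal.{u}}
    (hT : HasStatureLT T o) (h : S ⊆ T) (ho : o ≤ o') : HasStatureLT S o' := by
  have := hT.1
  have hi : TopologicalSpace.induced (inclusion h) inferInstance ≤
      (inferInstance : TopologicalSpace S) :=
    (IsEmbedding.inclusion h).isInducing.eq_induced.ge
  exact ⟨noetherianSpace_of_induced_le hi,
    (stature_le_of_induced_le hi).trans_lt (hT.2.trans_le ho)⟩

theorem HasStatureLT.image {Y Z : Type u} [TopologicalSpace Y] [TopologicalSpace Z] {S : Set Y}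
    {o : Ordinal.{u}} (hS : HasStatureLT S o) {f : Y → Z} (hf : Continuous f) :
    HasStatureLT (f '' S) o := by
  have := hS.1
  have hc : Continuous (fun x : S => (⟨f x, mem_image_of_mem f x.2⟩ : f '' S)) :=
    (hf.comp continuous_subtype_val).subtype_mk _
  have hs : Function.Surjective (fun x : S => (⟨f x, mem_image_of_mem f x.2⟩ : f '' S)) := by
    rintro ⟨_, x, hx, rfl⟩
    exact ⟨⟨x, hx⟩, rfl⟩
  exact ⟨noetherianSpace_of_surjective _ hc hs, (stature_le_of_surjective hc hs).trans_lt hS.2⟩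

theorem hasStatureLT_univ {Y : Type u} [TopologicalSpace Y] [NoetherianSpace Y] {o : Ordinal.{u}}
    (h : stature Y < o) : HasStatureLT (univ : Set Y) o :=
  ⟨inferInstance, (stature_le_of_induced_le (i := (Subtype.val : ↥(univ : Set Y) → Y))
    le_rfl).trans_lt h⟩

theorem hasStatureLT_empty {Y : Type u} [TopologicalSpace Y] {o : Ordinal.{u}} (ho : 0 < o) :
    HasStatureLT (∅ : Set Y) o :=
  ⟨inferInstance, (stature_eq_zero_iff.2 inferInstance).trans_lt ho⟩

theorem stature_union_le {Y : Type u} [TopologicalSpace Y] (S T : Set Y)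
    [NoetherianSpace S] [NoetherianSpace T] [NoetherianSpace ↥(S ∪ T)] :
    stature ↥(S ∪ T) ≤ hessenbergAdd (stature S) (stature T) := by
  let p : Closeds ↥(S ∪ T) → Closeds S :=
    fun C => C.preimage (continuous_inclusion subset_union_left)
  let q : Closeds ↥(S ∪ T) → Closeds T :=
    fun C => C.preimage (continuous_inclusion subset_union_right)
  have hp : Monotone p := fun C D h x hx => h hx
  have hq : Monotone q := fun C D h x hx => h hx
  refine (wfRank_le_of_strictMono
    (f := fun C => hessenbergAdd (wfRank (p C)) (wfRank (q C))) ?_ ⊤).trans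
    (hessenbergAdd_mono (wfRank_strictMono.monotone le_top) (wfRank_strictMono.monotone le_top))
  intro C D h
  obtain ⟨hle, ⟨y, hST⟩, hy, hyC⟩ := SetLike.lt_iff_le_and_exists.1 h
  rcases hST with hS | hT
  · have : p C < p D := SetLike.lt_iff_le_and_exists.2 ⟨hp hle, ⟨y, hS⟩, hy, hyC⟩
    exact (hessenbergAdd_lt_left (wfRank_strictMono this) _).trans_le
      (hessenbergAdd_mono le_rfl (wfRank_strictMono.monotone (hq hle)))
  · have : q C < q D := SetLike.lt_iff_le_and_exists.2 ⟨hq hle, ⟨y, hT⟩, hy, hyC⟩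
    exact (hessenbergAdd_lt_right _ (wfRank_strictMono this)).trans_le
      (hessenbergAdd_mono (wfRank_strictMono.monotone (hp hle)) le_rfl)

theorem HasStatureLT.union {Y : Type u} [TopologicalSpace Y] {S T : Set Y} {c : Ordinal.{u}}
    (hS : HasStatureLT S (Ordinal.omega0 ^ c)) (hT : HasStatureLT T (Ordinal.omega0 ^ c)) :
    HasStatureLT (S ∪ T) (Ordinal.omega0 ^ c) := by
  have := hS.1
  have := hT.1
  have : NoetherianSpace ↥(S ∪ T) := by
    rw [union_eq_iUnion]
    have : ∀ b : Bool, NoetherianSpace ↥(bif b then S else T) := by rintro (_ | _) <;> assumption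
    exact NoetherianSpace.iUnion _
  exact ⟨this, (stature_union_le S T).trans_lt
    (hessenbergAdd_lt_omega0_opow c _ hS.2 _ hT.2)⟩

theorem stature_add_stature_compl_le {Y : Type u} [TopologicalSpace Y] [NoetherianSpace Y]
    (C : Closeds Y) : stature (C : Set Y) + stature ↥(C : Set Y)ᶜ ≤ stature Y := by
  rw [stature_coe_closeds]
  let φ : Closeds ↥(C : Set Y)ᶜ → Closeds Y :=
    fun F => C ⊔ Closeds.closure (Subtype.val '' (F : Set ↥(C : Set Y)ᶜ))
  have hφ : StrictMono φ := by
    intro F G h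
    have h' := strictMono_closure_image (i := (Subtype.val : ↥(C : Set Y)ᶜ → Y)) le_rfl h
    refine lt_of_le_of_ne (sup_le_sup_left h'.le C) fun heq => ?_
    obtain ⟨hle, y, hy, hyF⟩ := SetLike.lt_iff_le_and_exists.1 h
    have h1 : (y : Y) ∈ φ G := Or.inr (subset_closure ⟨y, hy, rfl⟩)
    rw [← heq] at h1
    rcases h1 with h1 | h1
    · exact y.2 h1
    · apply hyF
      have : y ∈ closure (F : Set ↥(C : Set Y)ᶜ) := by
        rw [IsInducing.subtypeVal.closure_eq_preimage_closure_image]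
        exact h1
      rwa [F.isClosed.closure_eq] at this
  exact (wfRank_add_le hφ (fun F => le_sup_left) ⊤).trans (wfRank_strictMono.monotone le_top)

/-- A set of stature less than `ω ^ a` is a finite union of sets of stature at most `ω ^ b` with
`b < a`, in the form of an induction principle. -/
theorem HasStatureLT.induction {Y : Type u} [TopologicalSpace Y] {Φ : Set Y → Prop}
    (empty : Φ ∅) (union : ∀ S T, Φ S → Φ T → Φ (S ∪ T)) {a : Ordinal.{u}}
    (indecomposable : ∀ S : Set Y, ∀ b < a, NoetherianSpace S →
      stature S ≤ Ordinal.omega0 ^ b → Φ S)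
    {S : Set Y} (hS : HasStatureLT S (Ordinal.omega0 ^ a)) : Φ S := by
  obtain ⟨o, ho⟩ : ∃ o, stature S = o := ⟨_, rfl⟩
  induction o using WellFoundedLT.induction generalizing S with
  | ind o ih =>
  have := hS.1
  rcases eq_or_ne o 0 with rfl | h0
  · rw [stature_eq_zero_iff, isEmpty_coe_sort] at ho
    rwa [ho]
  have hba : Ordinal.log Ordinal.omega0 o < a :=
    (Ordinal.lt_opow_iff_log_lt Ordinal.one_lt_omega0 h0).1 (ho ▸ hS.2)
  have hbo : Ordinal.omega0 ^ Ordinal.log Ordinal.omega0 o ≤ o := Ordinal.opow_log_le_self _ h0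
  rcases hbo.eq_or_lt with heq | hlt
  · exact indecomposable S _ hba hS.1 (ho.trans heq.symm).le
  · obtain ⟨C, -, hC⟩ := exists_wfRank_eq (a := (⊤ : Closeds S)) (hlt.trans_eq ho.symm)
    have hsum := stature_add_stature_compl_le C
    rw [stature_coe_closeds, hC, ho] at hsum
    have hcompl : stature ↥(C : Set S)ᶜ < o := by
      refine lt_of_le_of_lt ?_ (Ordinal.sub_omega0_opow_log_lt h0)
      rwa [Ordinal.le_sub_of_le hbo]
    have hS' : S = Subtype.val '' (C : Set S) ∪ Subtype.val '' (C : Set S)ᶜ := by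
      rw [← image_union, union_compl_self, image_univ, Subtype.range_coe]
    have h1 : HasStatureLT (Subtype.val '' (C : Set S))
        (Order.succ (Ordinal.omega0 ^ Ordinal.log Ordinal.omega0 o)) :=
      HasStatureLT.image ⟨inferInstance, by
        rw [stature_coe_closeds, hC]; exact Order.lt_succ _⟩ continuous_subtype_val
    have h2 : HasStatureLT (Subtype.val '' (C : Set S)ᶜ) o :=
      HasStatureLT.image ⟨inferInstance, hcompl⟩ continuous_subtype_val
    rw [hS']
    refine union _ _ (indecomposable _ _ hba h1.1 (Order.lt_succ_iff.1 h1.2)) ?_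
    exact ih _ h2.2 ⟨h2.1, h2.2.trans (ho ▸ hS.2)⟩ rfl

theorem hasStatureLT_diff_of_isOpen {Y : Type u} [TopologicalSpace Y] {S U : Set Y}
    [NoetherianSpace S] (hU : IsOpen U) {x : Y} (hx : x ∈ S) (hxU : x ∈ U) :
    HasStatureLT (S \ U) (stature S) := by
  let C : Closeds S := ⟨Subtype.val ⁻¹' Uᶜ, hU.isClosed_compl.preimage continuous_subtype_val⟩
  have hC : C ≠ ⊤ := fun h => by
    have : (⟨x, hx⟩ : S) ∈ C := h ▸ trivial
    exact this hxU
  have h : HasStatureLT (C : Set S) (stature S) := ⟨inferInstance, stature_lt_of_isClosed hC⟩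
  refine (h.image continuous_subtype_val).mono ?_ le_rfl
  rintro y ⟨hy, hyU⟩
  exact ⟨⟨y, hy⟩, hyU, rfl⟩

theorem noetherianSpace_prod_and_stature_le {Y Z : Type u} [TopologicalSpace Y]
    [TopologicalSpace Z] (a : Ordinal.{u}) : ∀ (b : Ordinal.{u}) (C : Set Y) (D : Set Z),
    NoetherianSpace C → NoetherianSpace D → stature C ≤ Ordinal.omega0 ^ a →
    stature D ≤ Ordinal.omega0 ^ b → NoetherianSpace ↥(C ×ˢ D) ∧
      stature ↥(C ×ˢ D) ≤ Ordinal.omega0 ^ hessenbergAdd a b := by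
  induction a using WellFoundedLT.induction with
  | ind a iha =>
  intro b
  induction b using WellFoundedLT.induction with
  | ind b ihb =>
  intro C D hC hD hCa hDb
  have hlt : ∀ {x y : Ordinal.{u}}, x < y → Ordinal.omega0 ^ x < Ordinal.omega0 ^ y :=
    (Ordinal.opow_lt_opow_iff_right Ordinal.one_lt_omega0).2
  have hpos : 0 < Ordinal.omega0 ^ hessenbergAdd a b := Ordinal.opow_pos _ Ordinal.omega0_pos
  refine noetherianSpace_and_stature_le fun E hE => ?_
  obtain ⟨⟨⟨x, y⟩, hxC, hyD⟩, hxy⟩ : ∃ p, p ∉ E := by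
    by_contra! h
    exact hE (SetLike.ext fun p => ⟨fun _ => trivial, fun _ => h p⟩)
  obtain ⟨W, hW, hWE⟩ := isOpen_induced_iff.1 E.isClosed.isOpen_compl
  have hxyW : (x, y) ∈ W := by
    have : (⟨(x, y), hxC, hyD⟩ : ↥(C ×ˢ D)) ∈ Subtype.val ⁻¹' W := hWE ▸ hxy
    exact this
  obtain ⟨U, V, hU, hV, hxU, hyV, hUV⟩ := isOpen_prod_iff.1 hW x y hxyW
  have h1 : HasStatureLT ((C \ U) ×ˢ D) (Ordinal.omega0 ^ hessenbergAdd a b) := by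
    refine HasStatureLT.induction (Φ := fun T : Set Y => HasStatureLT (T ×ˢ D) _) ?_ ?_ ?_
      ((hasStatureLT_diff_of_isOpen hU hxC hxU).mono subset_rfl hCa)
    · simpa using hasStatureLT_empty hpos
    · intro S T hS hT
      rw [union_prod]
      exact hS.union hT
    · intro S a' ha' hS hSa'
      obtain ⟨h, h'⟩ := iha a' ha' b S D hS hD hSa' hDb
      exact ⟨h, h'.trans_lt (hlt (hessenbergAdd_lt_left ha' b))⟩
  have h2 : HasStatureLT (C ×ˢ (D \ V)) (Ordinal.omega0 ^ hessenbergAdd a b) := by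
    refine HasStatureLT.induction (Φ := fun T : Set Z => HasStatureLT (C ×ˢ T) _) ?_ ?_ ?_
      ((hasStatureLT_diff_of_isOpen hV hyD hyV).mono subset_rfl hDb)
    · simpa using hasStatureLT_empty hpos
    · intro S T hS hT
      rw [prod_union]
      exact hS.union hT
    · intro S b' hb' hS hSb'
      obtain ⟨h, h'⟩ := ihb b' hb' C S hC hS hCa hSb'
      exact ⟨h, h'.trans_lt (hlt (hessenbergAdd_lt_right a hb'))⟩
  have h3 : HasStatureLT (Subtype.val '' (E : Set ↥(C ×ˢ D)))
      (Ordinal.omega0 ^ hessenbergAdd a b) := by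
    refine (h1.union h2).mono ?_ le_rfl
    rintro _ ⟨⟨⟨u, v⟩, hu, hv⟩, huv, rfl⟩
    by_cases huU : u ∈ U
    · refine Or.inr ⟨hu, hv, fun hvV => ?_⟩
      have : (⟨(u, v), hu, hv⟩ : ↥(C ×ˢ D)) ∈ (E : Set ↥(C ×ˢ D))ᶜ :=
        hWE ▸ (hUV ⟨huU, hvV⟩ : (u, v) ∈ W)
      exact this huv
    · exact Or.inl ⟨⟨hu, huU⟩, hv⟩
  have := h3.1
  have hi := induced_le_of_comp
    (i := fun p : ↥(E : Set ↥(C ×ˢ D)) =>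
      (⟨p.1.1, p.1, p.2, rfl⟩ : ↥(Subtype.val '' (E : Set ↥(C ×ˢ D)))))
    (g := (Subtype.val : ↥(Subtype.val '' (E : Set ↥(C ×ˢ D))) → Y × Z)) continuous_subtype_val
    (IsInducing.comp (g := Subtype.val) (f := Subtype.val) IsInducing.subtypeVal
      IsInducing.subtypeVal)
  exact ⟨noetherianSpace_of_induced_le hi, (stature_le_of_induced_le hi).trans_lt h3.2⟩

theorem HasStatureLT.prod {Y Z : Type u} [TopologicalSpace Y] [TopologicalSpace Z] {C : Set Y}
    {D : Set Z} {g : Ordinal.{u}} (hC : HasStatureLT C (Ordinal.omega0 ^ (Ordinal.omega0 ^ g)))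
    (hD : HasStatureLT D (Ordinal.omega0 ^ (Ordinal.omega0 ^ g))) :
    HasStatureLT (C ×ˢ D) (Ordinal.omega0 ^ (Ordinal.omega0 ^ g)) := by
  have hpos : 0 < Ordinal.omega0 ^ (Ordinal.omega0 ^ g) := Ordinal.opow_pos _ Ordinal.omega0_pos
  refine HasStatureLT.induction (Φ := fun T : Set Y => HasStatureLT (T ×ˢ D) _) ?_ ?_ ?_ hC
  · simpa using hasStatureLT_empty hpos
  · intro S T hS hT
    rw [union_prod]
    exact hS.union hT
  intro S a ha hS hSa
  refine HasStatureLT.induction (Φ := fun T : Set Z => HasStatureLT (S ×ˢ T) _) ?_ ?_ ?_ hD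
  · simpa using hasStatureLT_empty hpos
  · intro T T' hT hT'
    rw [prod_union]
    exact hT.union hT'
  intro T b hb hT hTb
  obtain ⟨h, h'⟩ := noetherianSpace_prod_and_stature_le a b S T hS hT hSa hTb
  exact ⟨h, h'.trans_lt ((Ordinal.opow_lt_opow_iff_right Ordinal.one_lt_omega0).2
    (hessenbergAdd_lt_omega0_opow g _ ha _ hb))⟩

theorem stature_mul_stature_le {A B : Type u} [TopologicalSpace A] [TopologicalSpace B]
    [NoetherianSpace A] [NoetherianSpace B] [NoetherianSpace (A × B)] :
    stature A * stature B ≤ stature (A × B) := by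
  let ψ : Closeds B → Closeds (A × B) := fun D => D.preimage continuous_snd
  refine (wfRank_mul_le (⊤ : Closeds A) ψ ?_ ⊤).trans (wfRank_strictMono.monotone le_top)
  intro D D' h
  obtain ⟨hle, y, hy, hyD'⟩ := SetLike.lt_iff_le_and_exists.1 h
  refine ⟨fun C => ψ D' ⊔ (C.preimage continuous_fst ⊓ ψ D), ?_, fun _ => le_sup_left, ?_⟩
  · intro C C' hCC'
    obtain ⟨hle', x, hx, hxC⟩ := SetLike.lt_iff_le_and_exists.1 hCC'
    refine SetLike.lt_iff_le_and_exists.2 ⟨?_, (x, y), Or.inr ⟨hx, hy⟩, ?_⟩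
    · exact sup_le_sup_left (inf_le_inf_right _ fun p hp => hle' hp) _
    · rintro (h | ⟨h, -⟩)
      · exact hyD' h
      · exact hxC h
  · refine sup_le (fun p hp => hle hp) inf_le_right

end Stature

section Words

open Topology Set

namespace WordSpace

/-- `Matches Us w` means that `w` lies in the basic open set `X*U₁X*⋯X*UₙX*`. -/
def Matches {X : Type u} (Us : List (Set X)) (w : List X) : Prop :=
  ∃ l : List X, l.Sublist w ∧ List.Forall₂ (· ∈ ·) l Us

theorem matches_nil {X : Type u} (w : List X) : Matches [] w :=
  ⟨[], List.nil_sublist w, List.Forall₂.nil⟩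

theorem not_matches_cons_nil {X : Type u} (U : Set X) (Us : List (Set X)) :
    ¬ Matches (U :: Us) [] := by
  rintro ⟨l, hl, h⟩
  rw [List.sublist_nil] at hl
  subst hl
  cases h

theorem Matches.sublist {X : Type u} {Us : List (Set X)} {w w' : List X} (h : Matches Us w)
    (hw : w.Sublist w') : Matches Us w' :=
  let ⟨l, hl, hU⟩ := h
  ⟨l, hl.trans hw, hU⟩

theorem matches_cons_cons_iff {X : Type u} {U : Set X} {Us : List (Set X)} {x : X} {w : List X} :
    Matches (U :: Us) (x :: w) ↔ (x ∈ U ∧ Matches Us w) ∨ Matches (U :: Us) w := by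
  constructor
  · rintro ⟨l, hl, h⟩
    rcases List.sublist_cons_iff.1 hl with hl | ⟨r, rfl, hr⟩
    · exact Or.inr ⟨l, hl, h⟩
    · rw [List.forall₂_cons] at h
      exact Or.inl ⟨h.1, r, hr, h.2⟩
  · rintro (⟨hx, l, hl, h⟩ | h)
    · exact ⟨x :: l, hl.cons_cons x, List.Forall₂.cons hx h⟩
    · exact h.sublist (List.sublist_cons_self x w)

theorem matches_append_iff {X : Type u} {Us : List (Set X)} {v w : List X} :
    Matches Us (v ++ w) ↔ ∃ As Bs, Us = As ++ Bs ∧ Matches As v ∧ Matches Bs w := by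
  constructor
  · rintro ⟨l, hl, h⟩
    obtain ⟨l₁, l₂, rfl, h₁, h₂⟩ := List.sublist_append_iff.1 hl
    refine ⟨_, _, (List.take_append_drop l₁.length Us).symm, ⟨l₁, h₁, ?_⟩, ⟨l₂, h₂, ?_⟩⟩
    · exact (List.forall₂_take_append _ _ _ h.flip).flip
    · exact (List.forall₂_drop_append _ _ _ h.flip).flip
  · rintro ⟨As, Bs, rfl, ⟨l₁, h₁, h₁'⟩, ⟨l₂, h₂, h₂'⟩⟩
    exact ⟨l₁ ++ l₂, h₁.append h₂, List.rel_append h₁' h₂'⟩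

theorem isOpen_matches {X : Type u} [TopologicalSpace X] {Us : List (Set X)}
    (h : ∀ U ∈ Us, IsOpen U) : IsOpen {w : WordSpace X | Matches Us w} :=
  isOpen_generateFrom_of_mem ⟨Us, h, rfl⟩

theorem continuous_of_isOpen_matches {X : Type u} [TopologicalSpace X] {Y : Type*}
    [TopologicalSpace Y] {f : Y → WordSpace X}
    (h : ∀ Us : List (Set X), (∀ U ∈ Us, IsOpen U) → IsOpen {y | Matches Us (f y)}) :
    Continuous f := by
  refine continuous_generateFrom_iff.2 ?_
  rintro _ ⟨Us, hUs, rfl⟩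
  exact h Us hUs

/-- Concatenation of words. -/
def append {X : Type u} [TopologicalSpace X] (p : WordSpace X × WordSpace X) : WordSpace X :=
  List.append p.1 p.2

/-- The one-letter word. -/
def single {X : Type u} [TopologicalSpace X] (x : X) : WordSpace X := [x]

/-- Words over a subspace, as words over the whole space. -/
def incl {X : Type u} [TopologicalSpace X] (F : Set X) (w : WordSpace F) : WordSpace X :=
  List.map Subtype.val w

theorem continuous_append {X : Type u} [TopologicalSpace X] :
    Continuous (append : WordSpace X × WordSpace X → WordSpace X) := by
  refine continuous_of_isOpen_matches fun Us hUs => ?_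
  have : {p : WordSpace X × WordSpace X | Matches Us (append p)} =
      ⋃ (As : List (Set X)) (Bs : List (Set X)) (_ : Us = As ++ Bs),
        {v : WordSpace X | Matches As v} ×ˢ {w : WordSpace X | Matches Bs w} := by
    ext ⟨v, w⟩
    simp only [mem_iUnion, mem_prod, exists_prop]
    exact matches_append_iff
  rw [this]
  refine isOpen_iUnion fun As => isOpen_iUnion fun Bs => isOpen_iUnion fun h => ?_
  subst h
  exact (isOpen_matches fun U hU => hUs U (List.mem_append_left _ hU)).prod
    (isOpen_matches fun U hU => hUs U (List.mem_append_right _ hU))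

theorem continuous_single {X : Type u} [TopologicalSpace X] :
    Continuous (single : X → WordSpace X) := by
  refine continuous_of_isOpen_matches fun Us hUs => ?_
  match Us, hUs with
  | [], _ =>
    convert isOpen_univ using 1
    exact eq_univ_of_forall fun _ => matches_nil _
  | [U], hUs =>
    convert hUs U (List.mem_singleton_self U) using 1
    ext x
    have := not_matches_cons_nil U []
    simp only [mem_ofPred_eq, single, matches_cons_cons_iff, this, or_false, matches_nil, and_true]
  | U :: V :: Us, _ =>
    convert isOpen_empty using 1
    have h₁ := not_matches_cons_nil U (V :: Us)
    have h₂ := not_matches_cons_nil V Us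
    refine eq_empty_of_forall_notMem fun x hx => ?_
    simp only [mem_ofPred_eq, single, matches_cons_cons_iff, h₁, h₂, or_false, and_false] at hx

theorem matches_map_iff {X Y : Type u} {f : Y → X} {Us : List (Set X)} {w : List Y} :
    Matches Us (w.map f) ↔ Matches (Us.map (f ⁻¹' ·)) w := by
  induction w generalizing Us with
  | nil =>
    cases Us with
    | nil => simp [matches_nil]
    | cons U Us => simp [not_matches_cons_nil]
  | cons x w ih =>
    cases Us with
    | nil => simp [matches_nil]
    | cons U Us =>
      rw [List.map_cons, List.map_cons, matches_cons_cons_iff, matches_cons_cons_iff, ih, ih]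
      rfl

theorem continuous_incl {X : Type u} [TopologicalSpace X] (F : Set X) : Continuous (incl F) := by
  refine continuous_of_isOpen_matches fun Us hUs => ?_
  have : {w : WordSpace F | Matches Us (incl F w)} =
      {w : WordSpace F | Matches (Us.map (Subtype.val ⁻¹' ·)) w} := by
    ext w
    exact matches_map_iff
  rw [this]
  refine isOpen_matches fun U hU => ?_
  obtain ⟨V, hV, rfl⟩ := List.mem_map.1 hU
  exact (hUs V hV).preimage continuous_subtype_val

theorem range_incl {X : Type u} [TopologicalSpace X] (F : Set X) :
    range (incl F) = {w : WordSpace X | ∀ x, List.Mem x w → x ∈ F} := by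
  ext w
  constructor
  · rintro ⟨v, rfl⟩ x hx
    obtain ⟨y, -, rfl⟩ := List.mem_map.1 hx
    exact y.2
  · intro h
    exact ⟨List.attachWith w (· ∈ F) h, List.attachWith_map_subtype_val h⟩

/-- The words avoiding `X*UX*U₁X*⋯X*UₙX*` consist of a word over the complement of `U` followed,
possibly, by one letter and a word avoiding `X*U₁X*⋯X*UₙX*`. -/
theorem setOf_not_matches_cons_subset {X : Type u} [TopologicalSpace X] (U : Set X)
    (Us : List (Set X)) :
    {w : WordSpace X | ¬ Matches (U :: Us) w} ⊆
      range (incl Uᶜ) ∪ (fun p : WordSpace X × X × WordSpace X =>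
        append (p.1, append (single p.2.1, p.2.2))) ''
          (range (incl Uᶜ) ×ˢ (univ ×ˢ {w : WordSpace X | ¬ Matches Us w})) := by
  rw [range_incl]
  intro w
  change List X at w
  intro hw
  induction w with
  | nil => exact Or.inl fun x hx => (List.not_mem_nil hx).elim
  | cons x w ih =>
    change ¬ Matches (U :: Us) (x :: w) at hw
    rw [matches_cons_cons_iff, not_or, not_and] at hw
    by_cases hx : x ∈ U
    · exact Or.inr ⟨([], x, w), ⟨fun y hy => (List.not_mem_nil hy).elim, trivial, hw.1 hx⟩, rfl⟩
    · rcases ih hw.2 with h | ⟨⟨v, y, u⟩, ⟨hv, -, hu⟩, rfl⟩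
      · left
        intro y hy
        rcases List.mem_cons.1 hy with rfl | hy
        exacts [hx, h y hy]
      · right
        refine ⟨(List.cons x v, y, u), ⟨?_, trivial, hu⟩, rfl⟩
        intro z hz
        rcases List.mem_cons.1 hz with rfl | hz
        exacts [hx, hv z hz]

theorem hasStatureLT_setOf_not_matches {X : Type u} [TopologicalSpace X] [NoetherianSpace X]
    {g : Ordinal.{u}} (hX : stature X < Ordinal.omega0 ^ (Ordinal.omega0 ^ g))
    (ih : ∀ F : Set X, IsClosed F → F ≠ univ →
      HasStatureLT (univ : Set (WordSpace F)) (Ordinal.omega0 ^ (Ordinal.omega0 ^ g)))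
    (Us : List (Set X)) (hUs : ∀ U ∈ Us, IsOpen U ∧ U.Nonempty) :
    HasStatureLT {w : WordSpace X | ¬ Matches Us w} (Ordinal.omega0 ^ (Ordinal.omega0 ^ g)) := by
  induction Us with
  | nil =>
    convert hasStatureLT_empty (Ordinal.opow_pos _ Ordinal.omega0_pos) using 1
    exact eq_empty_of_forall_notMem fun w hw => hw (matches_nil _)
  | cons U Us ihU =>
    obtain ⟨hU, hU'⟩ := hUs U List.mem_cons_self
    have h₁ : HasStatureLT (range (incl Uᶜ)) (Ordinal.omega0 ^ (Ordinal.omega0 ^ g)) := by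
      rw [← image_univ]
      refine (ih Uᶜ hU.isClosed_compl ?_).image (continuous_incl _)
      rw [Ne, compl_univ_iff]
      exact hU'.ne_empty
    have h₂ := ihU fun V hV => hUs V (List.mem_cons_of_mem _ hV)
    refine HasStatureLT.mono (h₁.union ((h₁.prod ((hasStatureLT_univ hX).prod h₂)).image ?_))
      (setOf_not_matches_cons_subset U Us) le_rfl
    exact continuous_append.comp (continuous_fst.prodMk (continuous_append.comp
      ((continuous_single.comp (continuous_fst.comp continuous_snd)).prodMk
        (continuous_snd.comp continuous_snd))))

theorem noetherianSpace_and_stature_le {X : Type u} [TopologicalSpace X] [NoetherianSpace X]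
    {g : Ordinal.{u}} (hX : stature X < Ordinal.omega0 ^ (Ordinal.omega0 ^ g))
    (ih : ∀ F : Set X, IsClosed F → F ≠ univ →
      HasStatureLT (univ : Set (WordSpace F)) (Ordinal.omega0 ^ (Ordinal.omega0 ^ g))) :
    NoetherianSpace (WordSpace X) ∧
      stature (WordSpace X) ≤ Ordinal.omega0 ^ (Ordinal.omega0 ^ g) := by
  refine _root_.noetherianSpace_and_stature_le fun C hC => ?_
  obtain ⟨w, hw⟩ : ∃ w, w ∉ C := by
    by_contra! h
    exact hC (SetLike.ext fun p => ⟨fun _ => trivial, fun _ => h p⟩)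
  obtain ⟨s, ⟨T, ⟨hT, hTs⟩, rfl⟩, hws, hsC⟩ := (isTopologicalBasis_of_subbasis
    (rfl : WordSpace.instTopologicalSpace X = _)).exists_subset_of_mem_open
    (show w ∈ (C : Set (WordSpace X))ᶜ from hw) C.isClosed.isOpen_compl
  have key : ∀ s ∈ T, HasStatureLT (sᶜ : Set (WordSpace X))
      (Ordinal.omega0 ^ (Ordinal.omega0 ^ g)) := by
    intro s hs
    obtain ⟨Us, hUs, rfl⟩ := hTs hs
    refine hasStatureLT_setOf_not_matches hX ih Us fun U hU => ⟨hUs U hU, ?_⟩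
    obtain ⟨l, -, hl⟩ := hws _ hs
    obtain ⟨i, hi, rfl⟩ := List.getElem_of_mem hU
    exact ⟨_, hl.get (hl.length_eq ▸ hi) hi⟩
  have hU : HasStatureLT (⋃ s ∈ T, (sᶜ : Set (WordSpace X)))
      (Ordinal.omega0 ^ (Ordinal.omega0 ^ g)) := by
    clear hws hsC hTs
    induction T, hT using Set.Finite.induction_on with
    | empty => simpa using hasStatureLT_empty (Ordinal.opow_pos _ Ordinal.omega0_pos)
    | insert _ _ h =>
      rw [biUnion_insert]
      exact (key _ (mem_insert _ _)).union (h fun s hs => key s (mem_insert_of_mem _ hs))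
  refine hU.mono ?_ le_rfl
  intro v hv
  by_contra h
  simp only [mem_iUnion, mem_compl_iff, exists_prop, not_exists, not_and, not_not] at h
  exact hsC (mem_sInter.2 h) hv

end WordSpace

end Words

section LowerBound

open Topology Set

theorem stature_pow_le {A Z : Type u} [TopologicalSpace A] [NoetherianSpace A]
    [tZ : TopologicalSpace Z] [NoetherianSpace Z] (f : A → Z → Z) (T : ℕ → Set Z)
    (hT : (T 0).Nonempty) (hf : ∀ k a, ∀ z ∈ T k, f a z ∈ T (k + 1))
    (hi : ∀ k, TopologicalSpace.induced (fun p : A × T k => f p.1 p.2) tZ ≤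
      instTopologicalSpaceProd) (k : ℕ) : stature A ^ k ≤ stature Z := by
  have hsub : ∀ S : Set Z, stature S ≤ stature Z := fun S =>
    stature_le_of_induced_le (i := Subtype.val) le_rfl
  have hN : ∀ S : Set Z, NoetherianSpace S := fun S =>
    noetherianSpace_of_induced_le (i := Subtype.val) le_rfl
  refine le_trans ?_ (hsub (T k))
  induction k with
  | zero =>
    rw [pow_zero, Order.one_le_iff_pos, pos_iff_ne_zero, Ne, stature_eq_zero_iff,
      not_isEmpty_iff]
    exact hT.to_subtype
  | succ k ih =>
    let i : A × T k → T (k + 1) := fun p => ⟨f p.1 p.2, hf k p.1 p.2 p.2.2⟩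
    have hi' : TopologicalSpace.induced i instTopologicalSpaceSubtype ≤
        instTopologicalSpaceProd := by
      rw [instTopologicalSpaceSubtype, induced_compose]
      exact hi k
    have := noetherianSpace_of_induced_le hi'
    rw [pow_succ']
    exact (mul_le_mul_right ih _).trans ((stature_mul_stature_le).trans
      (stature_le_of_induced_le hi'))

namespace WordSpace

theorem Matches.of_cons {X : Type u} {U : Set X} {Us : List (Set X)} {w : List X}
    (h : Matches (U :: Us) w) : Matches Us w := by
  induction w with
  | nil => exact (not_matches_cons_nil _ _ h).elim
  | cons x w ih =>
    exact ((matches_cons_cons_iff.1 h).elim And.right ih).sublist (List.sublist_cons_self x w)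

theorem Matches.of_cons_cons {X : Type u} {U : Set X} {Us : List (Set X)} {x : X} {w : List X}
    (h : Matches (U :: Us) (x :: w)) : Matches Us w :=
  (matches_cons_cons_iff.1 h).elim And.right Matches.of_cons

theorem Matches.of_append {X : Type u} {Us Vs : List (Set X)} {w : List X}
    (h : Matches (Us ++ Vs) w) : Matches Vs w := by
  induction Us with
  | nil => exact h
  | cons U Us ih => exact ih h.of_cons

open Classical in
/-- The number of letters of a word lying in `U`. -/
noncomputable def weight {X : Type u} (U : Set X) (w : List X) : ℕ :=
  w.countP (· ∈ U)

theorem weight_cons_of_mem {X : Type u} {U : Set X} {x : X} (hx : x ∈ U) (w : List X) :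
    weight U (x :: w) = weight U w + 1 := by
  classical
  exact List.countP_cons_of_pos (decide_eq_true hx)

theorem weight_cons_of_notMem {X : Type u} {U : Set X} {x : X} (hx : x ∉ U) (w : List X) :
    weight U (x :: w) = weight U w := by
  classical
  exact List.countP_cons_of_neg fun h => hx (of_decide_eq_true h)

theorem weight_append_cons {X : Type u} {U : Set X} {v : List X} (hv : ∀ y ∈ v, y ∉ U) {x : X}
    (hx : x ∈ U) (u : List X) : weight U (v ++ x :: u) = weight U u + 1 := by
  induction v with
  | nil => exact weight_cons_of_mem hx u
  | cons y v ih =>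
    rw [List.cons_append, weight_cons_of_notMem (hv y List.mem_cons_self),
      ih fun z hz => hv z (List.mem_cons_of_mem _ hz)]

theorem weight_univ {X : Type u} (w : List X) : weight univ w = w.length := by
  induction w with
  | nil => rfl
  | cons x w ih => rw [weight_cons_of_mem (mem_univ x), ih, List.length_cons]

theorem matches_replicate_iff {X : Type u} {U : Set X} {n : ℕ} {w : List X} :
    Matches (List.replicate n U) w ↔ n ≤ weight U w := by
  induction w generalizing n with
  | nil =>
    cases n with
    | zero => simp [matches_nil]
    | succ n => simp [List.replicate_succ, not_matches_cons_nil, weight]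
  | cons x w ih =>
    cases n with
    | zero => simp [matches_nil]
    | succ n =>
      rw [List.replicate_succ, matches_cons_cons_iff, ← List.replicate_succ, ih, ih]
      by_cases hx : x ∈ U
      · rw [weight_cons_of_mem hx]
        simp only [hx, true_and]
        omega
      · rw [weight_cons_of_notMem hx]
        simp [hx]

theorem matches_append_replicate_iff {X : Type u} {U : Set X} {Us : List (Set X)} {v u : List X}
    {x : X} {k : ℕ} (hx : x ∈ U) (hu : weight U u = k) :
    Matches (Us ++ List.replicate (k + 1) U) (v ++ x :: u) ↔ Matches Us v := by
  constructor
  · induction v generalizing Us with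
    | nil =>
      cases Us with
      | nil => exact fun _ => matches_nil _
      | cons V Us =>
        intro h
        have h' : Matches (List.replicate (k + 1) U) u := h.of_cons_cons.of_append
        rw [matches_replicate_iff] at h'
        omega
    | cons y v ih =>
      cases Us with
      | nil => exact fun _ => matches_nil _
      | cons V Us =>
        rw [List.cons_append, List.cons_append, matches_cons_cons_iff, matches_cons_cons_iff]
        exact Or.imp (And.imp_right ih) (ih (Us := V :: Us))
  · refine fun h => matches_append_iff.2 ⟨_, _, rfl, h, matches_replicate_iff.2 ?_⟩
    rw [weight_cons_of_mem hx, hu]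

theorem matches_cons_append_iff {X : Type u} {U : Set X} {Us : List (Set X)} {v u : List X}
    {x : X} (hx : x ∈ U) (hv : ∀ y ∈ v, y ∉ U) :
    Matches (U :: Us) (v ++ x :: u) ↔ Matches Us u := by
  induction v with
  | nil => exact ⟨Matches.of_cons_cons, fun h => matches_cons_cons_iff.2 (Or.inl ⟨hx, h⟩)⟩
  | cons y v ih =>
    rw [List.cons_append, matches_cons_cons_iff,
      ih fun z hz => hv z (List.mem_cons_of_mem _ hz)]
    simp [hv y List.mem_cons_self]

/-- A topology on `Y` is finer than the one induced by a map `g` into a word space as soon as the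
preimages of the basic open sets are preimages of basic open sets under `f`. -/
theorem induced_le_induced {X X' : Type u} [TopologicalSpace X] [TopologicalSpace X'] {Y : Type*}
    {f : Y → WordSpace X} {g : Y → WordSpace X'}
    (h : ∀ Us : List (Set X'), (∀ U ∈ Us, IsOpen U) → ∃ Vs : List (Set X), (∀ V ∈ Vs, IsOpen V) ∧
      ∀ y, Matches Vs (f y) ↔ Matches Us (g y)) :
    TopologicalSpace.induced f (instTopologicalSpace X) ≤
      TopologicalSpace.induced g (instTopologicalSpace X') := by
  refine continuous_iff_le_induced.1 (@continuous_of_isOpen_matches X' _ Y (_) g fun Us hUs => ?_)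
  obtain ⟨Vs, hVs, h⟩ := h Us hUs
  exact isOpen_induced_iff.2 ⟨_, isOpen_matches hVs, ext h⟩

theorem isOpen_append_replicate {X : Type u} [TopologicalSpace X] {Us : List (Set X)} {U : Set X}
    {n : ℕ} (hUs : ∀ V ∈ Us, IsOpen V) (hU : IsOpen U) :
    ∀ V ∈ Us ++ List.replicate n U, IsOpen V := by
  intro V hV
  rcases List.mem_append.1 hV with hV | hV
  · exact hUs V hV
  · rwa [List.eq_of_mem_replicate hV]

theorem exists_map_preimage_eq {X : Type u} [TopologicalSpace X] {F : Set X}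
    {Us : List (Set F)} (hUs : ∀ U ∈ Us, IsOpen U) :
    ∃ Vs : List (Set X), (∀ V ∈ Vs, IsOpen V) ∧ Vs.map (Subtype.val ⁻¹' ·) = Us := by
  induction Us with
  | nil => exact ⟨[], by simp, rfl⟩
  | cons U Us ih =>
    obtain ⟨Vs, hVs, rfl⟩ := ih fun V hV => hUs V (List.mem_cons_of_mem _ hV)
    obtain ⟨V, hV, rfl⟩ := isOpen_induced_iff.1 (hUs U List.mem_cons_self)
    exact ⟨V :: Vs, List.forall_mem_cons.2 ⟨hV, hVs⟩, rfl⟩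

/-- Words with exactly `k` letters outside a closed set `F` faithfully encode `k` words over `F`. -/
theorem stature_wordSpace_pow_le {X : Type u} [TopologicalSpace X] [NoetherianSpace (WordSpace X)]
    {F : Set X} (hF : IsClosed F) (hF' : F ≠ univ) (k : ℕ) :
    stature (WordSpace F) ^ k ≤ stature (WordSpace X) := by
  obtain ⟨x, hx⟩ := (ne_univ_iff_exists_notMem F).1 hF'
  have hv : ∀ v : List F, ∀ y ∈ v.map Subtype.val, y ∉ Fᶜ := by
    intro v y hy
    obtain ⟨z, -, rfl⟩ := List.mem_map.1 hy
    exact not_not.2 z.2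
  have : NoetherianSpace (WordSpace F) := by
    refine noetherianSpace_of_induced_le (i := incl F) (le_trans (induced_le_induced
      (g := id) fun Us hUs => ?_) induced_id.le)
    obtain ⟨Vs, hVs, rfl⟩ := exists_map_preimage_eq hUs
    exact ⟨Vs, hVs, fun w => matches_map_iff⟩
  refine stature_pow_le (fun v u => append (incl F v, append (single x, u)))
    (fun k => {u : WordSpace X | weight Fᶜ u = k}) ⟨([] : List X), rfl⟩ (fun k v u hu => ?_)
    (fun k => le_inf (induced_le_induced fun Us hUs => ?_) ?_) k
  · exact (weight_append_cons (hv v) hx u).trans (congrArg (· + 1) hu)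
  · obtain ⟨Vs, hVs, rfl⟩ := exists_map_preimage_eq hUs
    refine ⟨_, isOpen_append_replicate (n := k + 1) hVs hF.isOpen_compl, fun p => ?_⟩
    exact (matches_append_replicate_iff hx p.2.2).trans matches_map_iff
  · have h : TopologicalSpace.induced _ _ ≤ TopologicalSpace.induced _ _ :=
      induced_le_induced (X := X) (X' := X)
        (f := fun p : WordSpace F × {u : WordSpace X | weight Fᶜ u = k} =>
          append (incl F p.1, append (single x, (p.2 : WordSpace X))))
        (g := fun p => (p.2 : WordSpace X)) fun Us hUs => ⟨Fᶜ :: Us,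
          List.forall_mem_cons.2 ⟨hF.isOpen_compl, hUs⟩,
          fun p => matches_cons_append_iff hx (hv p.1)⟩
    exact h.trans induced_compose.ge

theorem stature_pow_le_stature_wordSpace {X : Type u} [TopologicalSpace X] [NoetherianSpace X]
    [NoetherianSpace (WordSpace X)] (k : ℕ) : stature X ^ k ≤ stature (WordSpace X) := by
  refine stature_pow_le (fun x u => append (single x, u))
    (fun k => {u : WordSpace X | weight univ u = k}) ⟨([] : List X), rfl⟩ (fun k x u hu => ?_)
    (fun k => le_inf ?_ ?_) k
  · exact (weight_cons_of_mem (mem_univ x) u).trans (congrArg (· + 1) hu)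
  · refine (@continuous_iff_le_induced _ _ (_) _ _).1 (@Continuous.mk _ _ (_) _ _ fun U hU => ?_)
    refine isOpen_induced_iff.2 ⟨_, isOpen_matches (isOpen_append_replicate (Us := [U]) (n := k)
      (by simpa using hU) isOpen_univ), ext fun p => ?_⟩
    have hp : weight univ (p.2 : WordSpace X) = k := p.2.2
    have h₁ : Matches (List.replicate k (univ : Set X)) (p.2 : WordSpace X) :=
      matches_replicate_iff.2 hp.ge
    have h₂ : ¬ Matches (U :: List.replicate k (univ : Set X)) (p.2 : WordSpace X) := by
      rintro ⟨l, hl, h⟩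
      have h₃ := h.length_eq.symm.le.trans hl.length_le
      rw [← weight_univ (p.2 : WordSpace X), hp, List.length_cons, List.length_replicate] at h₃
      omega
    exact matches_cons_cons_iff.trans ⟨fun h => (h.resolve_right h₂).1, fun h => Or.inl ⟨h, h₁⟩⟩
  · have h : TopologicalSpace.induced _ _ ≤ TopologicalSpace.induced _ _ :=
      induced_le_induced (X := X) (X' := X)
        (f := fun p : X × {u : WordSpace X | weight univ u = k} =>
          append (single p.1, (p.2 : WordSpace X)))
        (g := fun p => (p.2 : WordSpace X)) fun Us hUs => ⟨univ :: Us,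
          List.forall_mem_cons.2 ⟨isOpen_univ, hUs⟩,
          fun p => matches_cons_append_iff (v := []) (mem_univ p.1) (by simp)⟩
    exact h.trans induced_compose.ge

end WordSpace

end LowerBound

section SchmidtPrime

open Ordinal

theorem schmidtPrime_natCast (n : ℕ) :
    schmidtPrime (n : Ordinal.{u}) = ((n - 1 : ℕ) : Ordinal) := by
  rw [schmidtPrime, if_pos (natCast_lt_omega0 n), Ordinal.natCast_sub, Nat.cast_one]

theorem schmidtPrime_of_special {e : Ordinal.{u}} (he : IsCritical e) (n : ℕ) :
    schmidtPrime (e + n) = e + n + 1 := by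
  have h1 : ω ≤ e := by
    have h0 : e ≠ 0 := by
      rintro rfl
      exact one_ne_zero ((opow_zero ω).symm.trans he)
    have h : ω ^ (1 : Ordinal) ≤ ω ^ e :=
      opow_le_opow_right omega0_pos (Order.one_le_iff_ne_zero.2 h0)
    rwa [opow_one, he] at h
  rw [schmidtPrime, if_neg (h1.trans le_self_add).not_gt, adjsw, if_pos ⟨e, n, he, rfl⟩]

theorem schmidtPrime_of_not_special {a : Ordinal.{u}} (ha : ω ≤ a)
    (h : ¬ ∃ (e : Ordinal.{u}) (n : ℕ), IsCritical e ∧ a = e + n) : schmidtPrime a = a := by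
  rw [schmidtPrime, if_neg ha.not_gt, adjsw, if_neg h]

theorem le_schmidtPrime {a : Ordinal.{u}} (ha : ω ≤ a) : a ≤ schmidtPrime a := by
  by_cases h : ∃ (e : Ordinal.{u}) (n : ℕ), IsCritical e ∧ a = e + n
  · obtain ⟨e, n, he, rfl⟩ := h
    rw [schmidtPrime_of_special he]
    exact le_self_add
  · exact (schmidtPrime_of_not_special ha h).ge

theorem schmidtPrime_lt_schmidtPrime {a b : Ordinal.{u}} (hb : b ≠ 0) (h : b < a) :
    schmidtPrime b < schmidtPrime a := by
  rcases lt_or_ge a ω with ha | ha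
  · obtain ⟨n, rfl⟩ := lt_omega0.1 ha
    obtain ⟨m, rfl⟩ := lt_omega0.1 (h.trans ha)
    rw [schmidtPrime_natCast, schmidtPrime_natCast]
    rw [Nat.cast_ne_zero] at hb
    rw [Nat.cast_lt] at *
    omega
  rcases lt_or_ge b ω with hb' | hb'
  · obtain ⟨m, rfl⟩ := lt_omega0.1 hb'
    rw [schmidtPrime_natCast]
    exact (natCast_lt_omega0 _).trans_le (ha.trans (le_schmidtPrime ha))
  by_cases hs : ∃ (e : Ordinal.{u}) (n : ℕ), IsCritical e ∧ b = e + n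
  · obtain ⟨e, n, he, rfl⟩ := hs
    rw [schmidtPrime_of_special he]
    rcases (Order.add_one_le_of_lt h).eq_or_lt with rfl | h
    · rw [add_assoc, ← Nat.cast_add_one, schmidtPrime_of_special he]
      exact lt_add_one _
    · exact h.trans_le (le_schmidtPrime ha)
  · rw [schmidtPrime_of_not_special hb' hs]
    exact h.trans_le (le_schmidtPrime ha)

theorem lt_opow_opow_schmidtPrime (a : Ordinal.{u}) : a < ω ^ ω ^ schmidtPrime a := by
  rcases lt_or_ge a ω with ha | ha
  · refine ha.trans_le ?_
    have h : ω ^ (1 : Ordinal) ≤ ω ^ ω ^ schmidtPrime a :=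
      opow_le_opow_right omega0_pos (Order.one_le_iff_pos.2 (opow_pos _ omega0_pos))
    rwa [opow_one] at h
  · by_cases hs : ∃ (e : Ordinal.{u}) (n : ℕ), IsCritical e ∧ a = e + n
    · obtain ⟨e, n, he, rfl⟩ := hs
      rw [schmidtPrime_of_special he]
      exact (lt_add_one _).trans_le ((right_le_opow _ one_lt_omega0).trans
        (right_le_opow _ one_lt_omega0))
    · rw [schmidtPrime_of_not_special ha hs]
      have h : a ≠ ω ^ a := fun h => hs ⟨a, 0, h.symm, by simp⟩
      exact ((right_le_opow a one_lt_omega0).lt_of_ne h).trans_le (right_le_opow _ one_lt_omega0)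

theorem exists_le_schmidtPrime_or_isCritical {a c : Ordinal.{u}} (h : c < schmidtPrime a) :
    (∃ b < a, b ≠ 0 ∧ c ≤ schmidtPrime b) ∨ (IsCritical a ∧ c ≤ a) := by
  have key : ∀ m : ℕ, (m : Ordinal.{u}) ≤ schmidtPrime ((m + 1 : ℕ) : Ordinal.{u}) := fun m => by
    rw [schmidtPrime_natCast, Nat.add_sub_cancel]
  rcases lt_or_ge a ω with ha | ha
  · obtain ⟨n, rfl⟩ := lt_omega0.1 ha
    rw [schmidtPrime_natCast] at h
    obtain ⟨m, rfl⟩ := lt_omega0.1 (h.trans (natCast_lt_omega0 _))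
    rw [Nat.cast_lt] at h
    exact Or.inl ⟨(m + 1 : ℕ), Nat.cast_lt.2 (by omega), Nat.cast_ne_zero.2 (by omega), key m⟩
  by_cases hs : ∃ (e : Ordinal.{u}) (n : ℕ), IsCritical e ∧ a = e + n
  · obtain ⟨e, n, he, rfl⟩ := hs
    rw [schmidtPrime_of_special he, Order.lt_add_one_iff] at h
    cases n with
    | zero =>
      rw [Nat.cast_zero, add_zero] at *
      exact Or.inr ⟨he, h⟩
    | succ n =>
      refine Or.inl ⟨e + n, ?_, ?_, ?_⟩
      · exact add_lt_add_right (Nat.cast_lt.2 n.lt_succ_self) e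
      · have h0 : e ≠ 0 := by
          rintro rfl
          exact one_ne_zero ((opow_zero ω).symm.trans he)
        exact fun h => h0 (Ordinal.add_eq_zero_iff.1 h).1
      · rwa [schmidtPrime_of_special he, add_assoc, ← Nat.cast_add_one]
  · rw [schmidtPrime_of_not_special ha hs] at h
    rcases lt_or_ge c ω with hc | hc
    · obtain ⟨m, rfl⟩ := lt_omega0.1 hc
      exact Or.inl ⟨(m + 1 : ℕ), (natCast_lt_omega0 _).trans_le ha,
        Nat.cast_ne_zero.2 m.succ_ne_zero, key m⟩
    · exact Or.inl ⟨c, h, (omega0_pos.trans_le hc).ne', le_schmidtPrime hc⟩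

end SchmidtPrime

section Main

open Ordinal Set

theorem omega0_le_stature_wordSpace {X : Type u} [TopologicalSpace X] [Nonempty X]
    [NoetherianSpace (WordSpace X)] : ω ≤ stature (WordSpace X) := by
  let C : ℕ → Closeds (WordSpace X) := fun k =>
    ⟨{w | WordSpace.Matches (List.replicate k Set.univ) w}ᶜ,
      (WordSpace.isOpen_matches fun U hU => by
        rw [List.eq_of_mem_replicate hU]
        exact isOpen_univ).isClosed_compl⟩
  have hC : ∀ (k : ℕ) (w : List X), w ∈ C k ↔ w.length < k := by
    intro k w
    change ¬ WordSpace.Matches _ w ↔ _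
    rw [WordSpace.matches_replicate_iff, WordSpace.weight_univ, not_le]
  have hlt : ∀ k, C k < C (k + 1) := by
    intro k
    have x : X := Classical.arbitrary X
    refine lt_of_le_not_ge (fun w hw => (hC _ w).2 (((hC _ w).1 hw).trans k.lt_succ_self)) ?_
    intro h
    have := (hC k (List.replicate k x)).1 (h ((hC (k + 1) (List.replicate k x)).2 (by simp)))
    simp at this
  have hk : ∀ k : ℕ, (k : Ordinal.{u}) ≤ wfRank (C k) := by
    intro k
    induction k with
    | zero => simp
    | succ k ih =>
      rw [Nat.cast_add_one]
      exact Order.add_one_le_of_lt (ih.trans_lt (wfRank_strictMono (hlt k)))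
  exact omega0_le.2 fun k => (hk k).trans (wfRank_strictMono.monotone le_top)

theorem stature_wordSpace_of_isEmpty {X : Type u} [TopologicalSpace X] [IsEmpty X] :
    NoetherianSpace (WordSpace X) ∧ stature (WordSpace X) = 1 := by
  have hnil : ∀ v w : WordSpace X, v = w := fun v w =>
    Subsingleton.elim (α := List X) v w
  obtain ⟨h₁, h₂⟩ := noetherianSpace_and_stature_le (Y := WordSpace X) (o := 1) fun C hC => by
    convert hasStatureLT_empty one_pos using 1
    refine eq_empty_of_forall_notMem fun w hw => hC (SetLike.ext fun v => ?_)
    exact ⟨fun _ => trivial, fun _ => hnil w v ▸ hw⟩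
  refine ⟨h₁, h₂.antisymm ?_⟩
  rw [Order.one_le_iff_pos, pos_iff_ne_zero, Ne, stature_eq_zero_iff, not_isEmpty_iff]
  exact ⟨([] : List X)⟩

theorem opow_opow_schmidtPrime_le_stature_wordSpace {X : Type u} [TopologicalSpace X]
    [NoetherianSpace X] [NoetherianSpace (WordSpace X)] (h0 : stature X ≠ 0)
    (ih : ∀ F : Set X, IsClosed F → F ≠ Set.univ → stature F ≠ 0 →
      ω ^ ω ^ schmidtPrime (stature F) ≤ stature (WordSpace F)) :
    ω ^ ω ^ schmidtPrime (stature X) ≤ stature (WordSpace X) := by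
  rcases eq_or_ne (schmidtPrime (stature X)) 0 with hs | hs
  · have : Nonempty X := by rwa [Ne, stature_eq_zero_iff, not_isEmpty_iff] at h0
    rw [hs, opow_zero, opow_one]
    exact omega0_le_stature_wordSpace
  refine le_of_forall_lt fun a ha => ?_
  obtain ⟨c, hc, n, han⟩ := (lt_omega0_omega0_opow hs).1 ha
  refine han.trans_le ?_
  have key : ∀ o d : Ordinal.{u}, c ≤ d → ω ^ ω ^ d ≤ o → ω ^ (ω ^ c * n) ≤ o ^ n := by
    intro o d hcd hdo
    rw [opow_mul, opow_natCast]
    exact pow_le_pow_left₀ (zero_le) ((opow_le_opow_right omega0_pos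
      (opow_le_opow_right omega0_pos hcd)).trans hdo) n
  rcases exists_le_schmidtPrime_or_isCritical hc with ⟨b, hb, hb0, hcb⟩ | ⟨hcrit, hca⟩
  · obtain ⟨C, hC, rfl⟩ := exists_wfRank_eq hb
    have hC' : (C : Set X) ≠ Set.univ := fun h => hC.ne (SetLike.coe_injective h)
    rw [← stature_coe_closeds] at hb0 hcb
    exact (key _ _ hcb (ih C C.isClosed hC' hb0)).trans
      (WordSpace.stature_wordSpace_pow_le C.isClosed hC' n)
  · refine (key _ _ hca ?_).trans (WordSpace.stature_pow_le_stature_wordSpace n)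
    have hcrit : ω ^ stature X = stature X := hcrit
    rw [hcrit, hcrit]

end Main

/-- For a Noetherian space `X` with `α := ‖X‖`, the word space `X*` is Noetherian with
stature `1` if `α = 0` and `ω ^ ω ^ α'` otherwise, where `α' = schmidtPrime α`. -/
theorem stature_wordSpace (X : Type u) [TopologicalSpace X] [NoetherianSpace X] :
    NoetherianSpace (WordSpace X) ∧
    (stature X = 0 → stature (WordSpace X) = 1) ∧
    (stature X ≠ 0 →
      stature (WordSpace X) =
        Ordinal.omega0 ^ (Ordinal.omega0 ^ schmidtPrime (stature X))) := by
  induction hα : stature X using WellFoundedLT.induction generalizing X with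
  | ind a ih =>
  subst hα
  rcases eq_or_ne (stature X) 0 with h0 | h0
  · have := stature_eq_zero_iff.1 h0
    obtain ⟨h₁, h₂⟩ := stature_wordSpace_of_isEmpty (X := X)
    exact ⟨h₁, fun _ => h₂, fun h => absurd h0 h⟩
  have hF : ∀ F : Set X, IsClosed F → F ≠ Set.univ → NoetherianSpace F ∧
      stature F < stature X := fun F hF hF' =>
    ⟨noetherianSpace_of_induced_le (i := Subtype.val) le_rfl,
      stature_lt_of_isClosed (C := ⟨F, hF⟩) fun h => hF' (congrArg SetLike.coe h)⟩
  obtain ⟨h₁, h₂⟩ := WordSpace.noetherianSpace_and_stature_le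
    (lt_opow_opow_schmidtPrime (stature X)) fun F hFc hF' => by
      obtain ⟨hFN, hlt⟩ := hF F hFc hF'
      obtain ⟨i₁, i₂, i₃⟩ := ih _ hlt F rfl
      refine hasStatureLT_univ ?_
      rcases eq_or_ne (stature F) 0 with hF0 | hF0
      · rw [i₂ hF0]
        refine Ordinal.one_lt_omega0.trans_le ?_
        exact Ordinal.left_le_opow _ (Ordinal.opow_pos _ Ordinal.omega0_pos)
      · rw [i₃ hF0]
        refine (Ordinal.opow_lt_opow_iff_right Ordinal.one_lt_omega0).2 ?_
        exact (Ordinal.opow_lt_opow_iff_right Ordinal.one_lt_omega0).2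
          (schmidtPrime_lt_schmidtPrime hF0 hlt)
  refine ⟨h₁, fun h => absurd h h0, fun _ => h₂.antisymm ?_⟩
  refine opow_opow_schmidtPrime_le_stature_wordSpace h0 fun F hFc hF' hF0 => ?_
  obtain ⟨hFN, hlt⟩ := hF F hFc hF'
  exact ((ih _ hlt F rfl).2.2 hF0).ge
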